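/- arXiv:1104.2527 — 5 statements merged into one kernel-verified Lean document; each statement's English description precedes it below -/
import Mathlib

section
/- Let F be a field and k, d ≥ 1. For tokens t : Fin k → (Fin d → F), define the augmented vectors v_t : Fin k → (Fin (k + d) → F) by letting v_t i be the concatenation of the i-th standard basis vector e_i of F^k with t i. If t, t' : Fin k → (Fin d → F) are two families of tokens such that the linear span of the range of v_t equals the linear span of the range of v_{t'} (as submodules of Fin (k + d) → F), then t = t'. -/
/-- A vector in the span of the augmented vectors `e_i ++ t i` is determined by its first `k`
coordinates, which are the coefficients of its last `d` coordinates in terms of the tokens. -/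
theorem apply_natAdd_eq_sum_of_mem_span_append {R : Type*} [CommSemiring R] {k d : ℕ}
    {t : Fin k → Fin d → R} {x : Fin (k + d) → R}
    (hx : x ∈ Submodule.span R
      (Set.range fun i : Fin k => Fin.append (Pi.single i (1 : R)) (t i))) (j : Fin d) :
    x (Fin.natAdd k j) = ∑ i, x (Fin.castAdd d i) * t i j := by
  induction hx using Submodule.span_induction with
  | mem x hx =>
    obtain ⟨i, rfl⟩ := hx
    simp [Pi.single_apply]
  | zero => simp
  | add x y _ _ hx hy => simp [hx, hy, add_mul, Finset.sum_add_distrib]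
  | smul a x _ hx => simp [hx, Finset.mul_sum, mul_assoc]

/-- If two families of tokens `t, t'` give rise to augmented vectors
`v_t i = e_i ++ t i` and `v_{t'} i = e_i ++ t' i` whose ranges have the same
linear span, then the token families are equal. -/
theorem stmt_4 (F : Type*) [Field F] (k d : ℕ) (hk : 1 ≤ k) (hd : 1 ≤ d)
    (t t' : Fin k → (Fin d → F))
    (hspan :
      Submodule.span F
          (Set.range (fun i : Fin k => Fin.append (Pi.single i (1 : F)) (t i))) =
        Submodule.span F
          (Set.range (fun i : Fin k => Fin.append (Pi.single i (1 : F)) (t' i)))) :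
    t = t' := by
  funext i j
  have hmem := hspan ▸ Submodule.subset_span (R := F)
    (Set.mem_range_self (f := fun i : Fin k => Fin.append (Pi.single i (1 : F)) (t i)) i)
  simpa [Pi.single_apply] using apply_natAdd_eq_sum_of_mem_span_append hmem j
end

section
/- Let F be a field and k, d ≥ 1. For tokens t : Fin k → (Fin d → F), define v i ∈ Fin (k + d) → F as the concatenation of the i-th standard basis vector e_i of F^k with t i, and let π : (Fin (k + d) → F) →ₗ (Fin k → F) be the linear projection onto the first k coordinates. Let W be a submodule of Fin (k + d) → F with W ≤ span{v i : i}, and let i be an index such that e_i lies in the image submodule π(W). Then v i ∈ W. -/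
/-- Let `v i = e_i ++ t i` be the augmented token vectors and let `π` be the linear
projection of `F^(k+d)` onto the first `k` coordinates. If `W` is a subspace of
`span {v i}` and the standard basis vector `e_i` lies in `π(W)`, then `v i ∈ W`:
a node can recover token `t i` iff the first `k` components of its received vectors
span the `i`-th unit vector. -/
theorem stmt_5 (F : Type*) [Field F] (k d : ℕ) (hk : 1 ≤ k) (hd : 1 ≤ d)
    (t : Fin k → (Fin d → F))
    (v : Fin k → (Fin (k + d) → F))
    (hv : ∀ i : Fin k, v i = Fin.append (Pi.single i (1 : F)) (t i))
    (π : (Fin (k + d) → F) →ₗ[F] (Fin k → F))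
    (hπ : π = LinearMap.funLeft F F (Fin.castAdd d))
    (W : Submodule F (Fin (k + d) → F))
    (hW : W ≤ Submodule.span F (Set.range v))
    (i : Fin k) (hi : Pi.single i (1 : F) ∈ W.map π) :
    v i ∈ W := by
  obtain ⟨w, hwW, hw⟩ := hi
  obtain ⟨c, rfl⟩ := (Submodule.mem_span_range_iff_exists_fun F).1 (hW hwW)
  have hπv : ∀ j, π (v j) = Pi.single j (1 : F) := fun j => by
    ext l
    simp [hπ, hv, LinearMap.funLeft_apply]
  have hc : c = Pi.single i (1 : F) := by
    rw [← hw, map_sum]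
    simp only [map_smul, hπv]
    exact pi_eq_sum_univ' c
  simpa [hc, Pi.single_apply, ite_smul] using hwW
end

section
/- Let G be a connected simple graph and let u, v, w, s be vertices such that G.dist u w + G.dist w v = G.dist u v (i.e., w lies on a shortest path from u to v) and G.dist v u ≤ G.dist v s. Then G.dist w u ≤ G.dist w s. -/
/-- If `w` lies on a shortest path from `u` to `v` and `u` is (weakly) closer to `v`
than `s` is, then `u` is also (weakly) closer to `w` than `s` is: ancestors in the
shortest-path tree of a patch are assigned to the same patch leader. -/
theorem stmt_9 (V : Type*) (G : SimpleGraph V) (hG : G.Connected)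
    (u v w s : V)
    (hpath : G.dist u w + G.dist w v = G.dist u v)
    (hclose : G.dist v u ≤ G.dist v s) :
    G.dist w u ≤ G.dist w s := by
  have htri : G.dist v s ≤ G.dist v w + G.dist w s := hG.dist_triangle
  rw [G.dist_comm (u := w) (v := u)]
  rw [G.dist_comm (u := v) (v := u)] at hclose
  rw [G.dist_comm (u := v) (v := w)] at htri
  omega
end

section
/- Let c > 0 be a real number and let T : ℕ → ℝ satisfy T 0 = 0 and, for every m ≥ 1, T m ≤ 1 + T (m - ⌈√(c * m)⌉) (where the ceiling is taken as a natural number and the subtraction is truncated natural subtraction). Then for every m ≥ 1, T m ≤ 1 + 2 * √(m / c). -/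
/-- The greedy-forward recurrence: if `T 0 = 0` and
`T m ≤ 1 + T (m - ⌈√(c·m)⌉)` for all `m ≥ 1`, then `T m ≤ 1 + 2·√(m / c)`. -/
theorem stmt_11 (c : ℝ) (hc : 0 < c) (T : ℕ → ℝ) (h0 : T 0 = 0)
    (hrec : ∀ m : ℕ, 1 ≤ m → T m ≤ 1 + T (m - ⌈Real.sqrt (c * m)⌉₊)) :
    ∀ m : ℕ, 1 ≤ m → T m ≤ 1 + 2 * Real.sqrt (m / c) := by
  intro m
  induction m using Nat.strong_induction_on with
  | _ m ih =>
    intro hm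
    have hm0 : (0 : ℝ) < m := by exact_mod_cast hm
    have hstep := hrec m hm
    have hceil : 0 < ⌈Real.sqrt (c * m)⌉₊ := Nat.ceil_pos.2 (Real.sqrt_pos.2 (by positivity))
    have hle := Nat.le_ceil (Real.sqrt (c * m))
    set r := ⌈Real.sqrt (c * m)⌉₊
    have hs0 := Real.sqrt_nonneg (m / c)
    rcases Nat.eq_zero_or_pos (m - r) with hz | hpos
    · rw [hz, h0] at hstep
      linarith
    · have hih := ih (m - r) (by omega) hpos
      have hcast : ((m - r : ℕ) : ℝ) = m - r := Nat.cast_sub (by omega)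
      have hpos' : (0 : ℝ) < m - r := by rw [← hcast]; exact_mod_cast hpos
      rw [hcast] at hih
      have hs2 : (m : ℝ) = c * Real.sqrt (m / c) ^ 2 := by
        rw [Real.sq_sqrt (by positivity)]
        field_simp
      have hcs : Real.sqrt (c * m) = c * Real.sqrt (m / c) := by
        rw [Real.sqrt_eq_iff_mul_self_eq (by positivity) (by positivity)]
        linear_combination c * hs2
      rw [hcs] at hle
      set s := Real.sqrt (m / c)
      have hs1 : 1 < s := by
        by_contra! h
        nlinarith [mul_nonneg (mul_nonneg hc.le hs0) (sub_nonneg.2 h)]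
      have hx : Real.sqrt ((m - r) / c) ≤ s - 1 / 2 := by
        rw [Real.sqrt_le_left (by linarith), div_le_iff₀ hc]
        nlinarith
      linarith
end

section
/- Let c > 0 be a real number, let k ≥ 1, and let α : Fin k → ℝ satisfy 0 ≤ α i ≤ 2/c for every i and ∑_i α i = 1. Then ∑_i (α i) * exp(-c * (α i)) ≤ exp(-c / k). -/
/-- The function `x ↦ x * exp (-c * x)` is concave on `[0, 2 / c]`. -/
theorem concaveOn_mul_exp_neg_mul {c : ℝ} (hc : 0 < c) :
    ConcaveOn ℝ (Set.Icc 0 (2 / c)) fun x : ℝ => x * Real.exp (-c * x) := by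
  have hexp (x : ℝ) : HasDerivAt (fun x => Real.exp (-c * x)) (Real.exp (-c * x) * -c) x := by
    simpa using ((hasDerivAt_id x).const_mul (-c)).exp
  refine concaveOn_of_hasDerivWithinAt2_nonpos (convex_Icc _ _) (by fun_prop)
    (f' := fun x => (1 - c * x) * Real.exp (-c * x))
    (f'' := fun x => c * (c * x - 2) * Real.exp (-c * x)) ?_ ?_ ?_
  · intro x _
    exact (((hasDerivAt_id x).mul (hexp x)).congr_deriv (by simp only [id]; ring)).hasDerivWithinAt
  · intro x _
    exact (((((hasDerivAt_id x).const_mul c).const_sub 1).mul (hexp x)).congr_deriv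
      (by simp only [id]; ring)).hasDerivWithinAt
  · intro x hx
    have hx' : x ≤ 2 / c := (interior_subset hx).2
    rw [le_div_iff₀ hc] at hx'
    exact mul_nonpos_of_nonpos_of_nonneg
      (mul_nonpos_of_nonneg_of_nonpos hc.le (by linarith)) (Real.exp_pos _).le

/-- Optimization step in the priority-forward analysis: if `α : Fin k → ℝ` has
nonnegative entries, each at most `2/c`, summing to `1`, then
`∑ i, α i · exp (−c · α i) ≤ exp (−c / k)`. -/
theorem stmt_13 (c : ℝ) (hc : 0 < c) (k : ℕ) (hk : 1 ≤ k)
    (α : Fin k → ℝ) (h0 : ∀ i, 0 ≤ α i) (h2 : ∀ i, α i ≤ 2 / c)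
    (hsum : ∑ i, α i = 1) :
    ∑ i, α i * Real.exp (-c * α i) ≤ Real.exp (-c / k) := by
  have hk' : (0 : ℝ) < k := by exact_mod_cast hk
  have jensen := (concaveOn_mul_exp_neg_mul hc).le_map_sum (t := Finset.univ)
    (w := fun _ : Fin k => (k : ℝ)⁻¹) (p := α) (fun _ _ => by positivity)
    (by simp [hk'.ne']) (fun i _ => ⟨h0 i, h2 i⟩)
  simp only [smul_eq_mul, ← Finset.mul_sum, hsum, mul_one] at jensen
  rw [div_eq_mul_inv]
  exact le_of_mul_le_mul_left jensen (inv_pos.mpr hk')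
end
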